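/- Let d ≥ 3 and consider the FA1f model on ℤ^d with parameter q ∈ (0,1) small. Let Λ = {0,...,ℓ−1}^d with ℓ = ⌊1/q⌋, and let f(η) be the number of connected clusters of empty sites in Λ. Then the Dirichlet form satisfies D(f) = q(1−q)·Σ_{x∈ℤ^d} μ(c_x(η)(f(η^x)−f(η))²) ≤ C q^{3−d} for a constant C depending only on d. -/

import Mathlib

open Finset

noncomputable section

/-- The configuration `η` flipped at the site `x`. -/
def flipCfg {d : ℕ} (η : (Fin d → ℤ) → Bool) (x : Fin d → ℤ) : (Fin d → ℤ) → Bool :=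
  fun y => if y = x then !(η y) else η y

/-- The nearest neighbours of a site `x ∈ ℤ^d`. -/
def latNbrs {d : ℕ} (x : Fin d → ℤ) : Finset (Fin d → ℤ) :=
  Finset.univ.biUnion fun i : Fin d =>
    {Function.update x i (x i + 1), Function.update x i (x i - 1)}

/-- Extension of a configuration on a finite set of sites by fully occupied outside. -/
def extendCfg {d : ℕ} (s : Finset (Fin d → ℤ)) (η : ↥s → Bool) : (Fin d → ℤ) → Bool :=
  fun x => if h : x ∈ s then η ⟨x, h⟩ else true

/-- Expectation, under the product Bernoulli(1−q) measure (`true` = occupied, probability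
`1−q`; `false` = empty, probability `q`), of a function depending only on the sites in the
finite set `s`. -/
def Eloc {d : ℕ} (q : ℝ) (s : Finset (Fin d → ℤ)) (g : ((Fin d → ℤ) → Bool) → ℝ) : ℝ :=
  ∑ η : ↥s → Bool, (∏ v : ↥s, if η v then (1 - q) else q) * g (extendCfg s η)

/-- The FA1f constraint at `x` (as a real indicator): some nearest neighbour of `x` is empty. -/
def cInd {d : ℕ} (η : (Fin d → ℤ) → Bool) (x : Fin d → ℤ) : ℝ :=
  if ∃ y ∈ latNbrs x, η y = false then 1 else 0

/-- The FA1f Dirichlet form `D(f) = q(1−q) Σ_x μ(c_x (f(η^x) − f(η))²)` of a function `f`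
depending only on the sites in the finite set `s`. -/
def Dform {d : ℕ} (q : ℝ) (s : Finset (Fin d → ℤ)) (f : ((Fin d → ℤ) → Bool) → ℝ) : ℝ :=
  q * (1 - q) * ∑' x : Fin d → ℤ,
    Eloc q (s ∪ insert x (latNbrs x))
      (fun η => cInd η x * (f (flipCfg η x) - f η) ^ 2)

/-- `f` depends only on the sites in `s`. -/
def localOn {d : ℕ} (s : Finset (Fin d → ℤ)) (f : ((Fin d → ℤ) → Bool) → ℝ) : Prop :=
  ∀ η η' : (Fin d → ℤ) → Bool, (∀ x ∈ s, η x = η' x) → f η = f η'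

/-- Variance of a function depending only on the sites in `s`. -/
def Varloc {d : ℕ} (q : ℝ) (s : Finset (Fin d → ℤ)) (f : ((Fin d → ℤ) → Bool) → ℝ) : ℝ :=
  Eloc q s fun η => (f η - Eloc q s f) ^ 2

/-- Membership in the box `Λ = {0,…,ℓ−1}^d ⊂ ℤ^d`. -/
def inBox {d : ℕ} (ℓ : ℕ) (x : Fin d → ℤ) : Prop := ∀ i, 0 ≤ x i ∧ x i < ℓ

instance {d ℓ : ℕ} (x : Fin d → ℤ) : Decidable (inBox ℓ x) := by
  unfold inBox; infer_instance

/-- The nearest-neighbour graph on the empty sites of `η` lying in `Λ`. -/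
def emptyGraphZ {d : ℕ} (ℓ : ℕ) (η : (Fin d → ℤ) → Bool) :
    SimpleGraph {x : Fin d → ℤ // inBox ℓ x ∧ η x = false} :=
  SimpleGraph.fromRel fun a b => ∑ i, |a.1 i - b.1 i| = 1

/-- The number of connected clusters of empty sites of `η` within `Λ`. -/
def clusterCountZ {d : ℕ} (ℓ : ℕ) (η : (Fin d → ℤ) → Bool) : ℕ :=
  Nat.card (emptyGraphZ ℓ η).ConnectedComponent

/-- The box `Λ = {0,…,ℓ−1}^d` as a finite set of sites. -/
def boxFinset (d ℓ : ℕ) : Finset (Fin d → ℤ) :=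
  Fintype.piFinset fun _ => Finset.Ico (0 : ℤ) ℓ

/-! ### Graph part -/

/-- Key lemma: connectivity in `G` versus connectivity after deleting the vertex `x`. -/
theorem reach_key {V W : Type*} (G : SimpleGraph V) (H : SimpleGraph W) (x : V) (f : W → V)
    (hr : ∀ v, v ≠ x → ∃ w, f w = v) (hx : ∀ w, f w ≠ x) (hinj : Function.Injective f)
    (hadj : ∀ a b, G.Adj (f a) (f b) → H.Adj a b) (u : W) (v : V)
    (h : G.Reachable (f u) v) :
    (v = x → ∃ n, G.Adj x (f n) ∧ H.Reachable u n) ∧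
    (∀ w, f w = v → H.Reachable u w ∨ ((∃ n, G.Adj x (f n) ∧ H.Reachable u n) ∧
      ∃ m, G.Adj x (f m) ∧ H.Reachable w m)) := by
  rw [SimpleGraph.reachable_iff_reflTransGen] at h
  induction h with
  | refl =>
    refine ⟨fun h => absurd h (hx u), fun w hw => Or.inl ?_⟩
    rw [hinj hw]
  | @tail b c _ hbc ih =>
    obtain ⟨ih1, ih2⟩ := ih
    by_cases hb : b = x
    · subst hb
      obtain ⟨n, hn⟩ := ih1 rfl
      refine ⟨fun hc => absurd hc hbc.ne', fun w hw => Or.inr ⟨⟨n, hn⟩, w, ?_, .refl _⟩⟩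
      rw [hw]; exact hbc
    · obtain ⟨b', rfl⟩ := hr b hb
      constructor
      · rintro rfl
        rcases ih2 b' rfl with h | ⟨h, _⟩
        · exact ⟨b', hbc.symm, h⟩
        · exact h
      · rintro w rfl
        have hbw := hadj _ _ hbc
        rcases ih2 b' rfl with h | ⟨h, m, hm, hm'⟩
        · exact Or.inl (h.trans hbw.reachable)
        · exact Or.inr ⟨h, m, hm, hbw.symm.reachable.trans hm'⟩

theorem cc_bounds {V W : Type*} [Finite V] [Finite W] (G : SimpleGraph V) (H : SimpleGraph W)
    (x : V) (f : W → V)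
    (hr : ∀ v, v ≠ x → ∃ w, f w = v) (hx : ∀ w, f w ≠ x) (hinj : Function.Injective f)
    (hadj : ∀ a b, G.Adj (f a) (f b) ↔ H.Adj a b) :
    Nat.card G.ConnectedComponent ≤ Nat.card H.ConnectedComponent + 1 ∧
    Nat.card H.ConnectedComponent ≤ Nat.card G.ConnectedComponent
      + Nat.card {n : W // G.Adj x (f n)} ∧
    ((∃ n, G.Adj x (f n)) → (∀ n m, G.Adj x (f n) → G.Adj x (f m) → n = m) →
      Nat.card G.ConnectedComponent = Nat.card H.ConnectedComponent) := by
  classical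
  have key := reach_key G H x f hr hx hinj (fun a b => (hadj a b).1)
  let F : H →g G := ⟨f, fun {a b} h => (hadj a b).2 h⟩
  let φ : H.ConnectedComponent → G.ConnectedComponent := SimpleGraph.ConnectedComponent.map F
  have hφ : ∀ w, φ (H.connectedComponentMk w) = G.connectedComponentMk (f w) := fun w => rfl
  refine ⟨?_, ?_, ?_⟩
  · let ψ : Option H.ConnectedComponent → G.ConnectedComponent :=
      fun o => o.elim (G.connectedComponentMk x) φ
    have hs : Function.Surjective ψ := by
      intro c
      induction c using SimpleGraph.ConnectedComponent.ind with
      | h v =>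
        by_cases hv : v = x
        · exact ⟨none, by rw [hv]; rfl⟩
        · obtain ⟨w, rfl⟩ := hr v hv
          exact ⟨some (H.connectedComponentMk w), rfl⟩
    have := Nat.card_le_card_of_surjective ψ hs
    rwa [Finite.card_option] at this
  · let ψ : H.ConnectedComponent → G.ConnectedComponent ⊕ {n : W // G.Adj x (f n)} :=
      fun c => if h : ∃ n : {n : W // G.Adj x (f n)}, H.connectedComponentMk n.1 = c then
        Sum.inr h.choose else Sum.inl (φ c)
    have hi : Function.Injective ψ := by
      intro c c' hcc
      by_cases h : ∃ n : {n : W // G.Adj x (f n)}, H.connectedComponentMk n.1 = c <;>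
      by_cases h' : ∃ n : {n : W // G.Adj x (f n)}, H.connectedComponentMk n.1 = c'
      · simp only [ψ, dif_pos h, dif_pos h'] at hcc
        have e := Sum.inr_injective hcc
        rw [← h.choose_spec, ← h'.choose_spec, e]
      · simp only [ψ, dif_pos h, dif_neg h'] at hcc
        cases hcc
      · simp only [ψ, dif_neg h, dif_pos h'] at hcc
        cases hcc
      · simp only [ψ, dif_neg h, dif_neg h'] at hcc
        have e := Sum.inl_injective hcc
        induction c using SimpleGraph.ConnectedComponent.ind with
        | h u =>
        induction c' using SimpleGraph.ConnectedComponent.ind with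
        | h v =>
        rw [hφ, hφ, SimpleGraph.ConnectedComponent.eq] at e
        rcases (key u (f v) e).2 v rfl with h1 | ⟨⟨n, hn, hn'⟩, _⟩
        · exact SimpleGraph.ConnectedComponent.eq.2 h1
        · exact absurd ⟨⟨n, hn⟩, SimpleGraph.ConnectedComponent.eq.2 hn'.symm⟩ h
    have := Nat.card_le_card_of_injective ψ hi
    rwa [Nat.card_sum] at this
  · rintro ⟨n, hn⟩ huniq
    refine (Nat.card_eq_of_bijective φ ⟨?_, ?_⟩).symm
    · intro c c' e
      induction c using SimpleGraph.ConnectedComponent.ind with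
      | h u =>
      induction c' using SimpleGraph.ConnectedComponent.ind with
      | h v =>
      rw [hφ, hφ, SimpleGraph.ConnectedComponent.eq] at e
      rcases (key u (f v) e).2 v rfl with h1 | ⟨⟨a, ha, ha'⟩, b, hb, hb'⟩
      · exact SimpleGraph.ConnectedComponent.eq.2 h1
      · rw [huniq b a hb ha] at hb'
        exact SimpleGraph.ConnectedComponent.eq.2 (ha'.trans hb'.symm)
    · intro c
      induction c using SimpleGraph.ConnectedComponent.ind with
      | h v =>
        by_cases hv : v = x
        · refine ⟨H.connectedComponentMk n, ?_⟩
          rw [hφ, hv, SimpleGraph.ConnectedComponent.eq]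
          exact hn.symm.reachable
        · obtain ⟨w, rfl⟩ := hr v hv
          exact ⟨H.connectedComponentMk w, rfl⟩

/-! ### Lattice part -/

theorem mem_latNbrs_iff {d : ℕ} (x y : Fin d → ℤ) :
    y ∈ latNbrs x ↔ ∃ i, y = Function.update x i (x i + 1) ∨ y = Function.update x i (x i - 1) := by
  simp [latNbrs]

theorem l1_iff {d : ℕ} (x y : Fin d → ℤ) : ∑ i, |x i - y i| = 1 ↔ y ∈ latNbrs x := by
  rw [mem_latNbrs_iff]
  constructor
  · intro h
    have hex : ∃ i, x i ≠ y i := by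
      by_contra hc
      push Not at hc
      simp [hc] at h
    obtain ⟨i, hi⟩ := hex
    have h1 : 1 ≤ |x i - y i| := Int.one_le_abs (sub_ne_zero.2 hi)
    rw [← Finset.add_sum_erase _ _ (Finset.mem_univ i)] at h
    have h2 : 0 ≤ ∑ j ∈ Finset.univ.erase i, |x j - y j| :=
      Finset.sum_nonneg fun _ _ => abs_nonneg _
    have h3 : ∑ j ∈ Finset.univ.erase i, |x j - y j| = 0 := by omega
    rw [Finset.sum_eq_zero_iff_of_nonneg (fun _ _ => abs_nonneg _)] at h3
    have h4 : ∀ j, j ≠ i → y j = x j := by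
      intro j hj
      have := h3 j (Finset.mem_erase.2 ⟨hj, Finset.mem_univ _⟩)
      rw [abs_eq_zero] at this
      omega
    have h5 : |x i - y i| = 1 := by omega
    refine ⟨i, ?_⟩
    rcases (abs_eq (by norm_num)).1 h5 with h6 | h6
    · right
      funext j
      by_cases hj : j = i
      · subst hj; simp; omega
      · simp [hj, h4 j hj]
    · left
      funext j
      by_cases hj : j = i
      · subst hj; simp; omega
      · simp [hj, h4 j hj]
  · rintro ⟨i, rfl | rfl⟩
    · rw [Finset.sum_eq_single i]
      · simp
      · intro j _ hj; simp [hj]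
      · simp
    · rw [Finset.sum_eq_single i]
      · simp
      · intro j _ hj; simp [hj]
      · simp

theorem card_latNbrs_le {d : ℕ} (x : Fin d → ℤ) : (latNbrs x).card ≤ 2 * d := by
  unfold latNbrs
  refine Finset.card_biUnion_le.trans ?_
  refine (Finset.sum_le_sum fun i _ => Finset.card_le_two).trans ?_
  simp [mul_comm]

theorem emptyGraph_adj {d ℓ : ℕ} {η : (Fin d → ℤ) → Bool}
    (a b : {x : Fin d → ℤ // inBox ℓ x ∧ η x = false}) :
    (emptyGraphZ ℓ η).Adj a b ↔ b.1 ∈ latNbrs a.1 := by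
  rw [← l1_iff]
  have hs : ∑ i, |b.1 i - a.1 i| = ∑ i, |a.1 i - b.1 i| :=
    Finset.sum_congr rfl fun i _ => abs_sub_comm _ _
  simp only [emptyGraphZ, SimpleGraph.fromRel_adj, hs, or_self, and_iff_right_iff_imp]
  rintro h rfl
  simp at h

theorem mem_box {d ℓ : ℕ} (x : Fin d → ℤ) : x ∈ boxFinset d ℓ ↔ inBox ℓ x := by
  simp [boxFinset, inBox]

theorem finite_sites {d ℓ : ℕ} (η : (Fin d → ℤ) → Bool) :
    Finite {x : Fin d → ℤ // inBox ℓ x ∧ η x = false} :=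
  Set.Finite.subset (boxFinset d ℓ).finite_toSet
    (fun x hx => by simpa [mem_box] using hx.1)

/-- Effect of opening up the site `x`. -/
theorem cluster_bounds {d ℓ : ℕ} (η₀ η₁ : (Fin d → ℤ) → Bool) (x : Fin d → ℤ)
    (hx : inBox ℓ x) (h0 : η₀ x = true) (h1 : η₁ x = false) (heq : ∀ y, y ≠ x → η₀ y = η₁ y) :
    clusterCountZ ℓ η₁ ≤ clusterCountZ ℓ η₀ + 1 ∧
    clusterCountZ ℓ η₀ ≤ clusterCountZ ℓ η₁ + 2 * d ∧
    ((∃ y ∈ latNbrs x, inBox ℓ y ∧ η₀ y = false) →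
      (∀ y ∈ latNbrs x, ∀ z ∈ latNbrs x, η₀ y = false → η₀ z = false → y = z) →
      clusterCountZ ℓ η₁ = clusterCountZ ℓ η₀) := by
  have ne : ∀ y, η₀ y = false → y ≠ x := by
    rintro y hy rfl
    rw [h0] at hy; cases hy
  have := finite_sites (ℓ := ℓ) η₀
  have := finite_sites (ℓ := ℓ) η₁
  let f : {x : Fin d → ℤ // inBox ℓ x ∧ η₀ x = false} →
      {x : Fin d → ℤ // inBox ℓ x ∧ η₁ x = false} :=
    fun w => ⟨w.1, w.2.1, by rw [← heq w.1 (ne _ w.2.2)]; exact w.2.2⟩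
  let x' : {x : Fin d → ℤ // inBox ℓ x ∧ η₁ x = false} := ⟨x, hx, h1⟩
  obtain ⟨b1, b2, b3⟩ := cc_bounds (emptyGraphZ ℓ η₁) (emptyGraphZ ℓ η₀) x' f
    (by
      intro v hv
      have hv' : v.1 ≠ x := fun h => hv (Subtype.ext h)
      exact ⟨⟨v.1, v.2.1, by rw [heq _ hv']; exact v.2.2⟩, rfl⟩)
    (fun w hw => ne _ w.2.2 (congrArg Subtype.val hw))
    (fun a b hab => by
      have h : (f a).1 = (f b).1 := congrArg Subtype.val hab
      exact Subtype.ext h)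
    (fun a b => by rw [emptyGraph_adj, emptyGraph_adj])
  refine ⟨b1, b2.trans (Nat.add_le_add_left ?_ _), ?_⟩
  · let g : {n : {x : Fin d → ℤ // inBox ℓ x ∧ η₀ x = false} //
            (emptyGraphZ ℓ η₁).Adj x' (f n)} → {y // y ∈ latNbrs x} :=
      fun n => ⟨n.1.1, (emptyGraph_adj x' (f n.1)).1 n.2⟩
    have hi : Function.Injective g := by
      intro a b hab
      have h : (g a).1 = (g b).1 := congrArg Subtype.val hab
      exact Subtype.ext (Subtype.ext h)
    have := Nat.card_le_card_of_injective g hi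
    refine this.trans ?_
    simpa using card_latNbrs_le x
  · rintro ⟨y, hy, hyb, hye⟩ hu
    refine b3 ⟨⟨y, hyb, hye⟩, (emptyGraph_adj x' (f ⟨y, hyb, hye⟩)).2 hy⟩ ?_
    intro n m hn hm
    exact Subtype.ext (hu n.1 ((emptyGraph_adj x' (f n)).1 hn) m.1
      ((emptyGraph_adj x' (f m)).1 hm) n.2.2 m.2.2)

theorem self_notMem_latNbrs {d : ℕ} (x : Fin d → ℤ) : x ∉ latNbrs x := by
  rw [← l1_iff]; simp

theorem flip_bounds {d ℓ : ℕ} (η : (Fin d → ℤ) → Bool) (x : Fin d → ℤ) (hx : inBox ℓ x) :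
    ((clusterCountZ ℓ (flipCfg η x) : ℝ) - clusterCountZ ℓ η) ^ 2 ≤ (2 * d + 1) ^ 2 ∧
    ((∃ y ∈ latNbrs x, inBox ℓ y ∧ η y = false) →
      (∀ y ∈ latNbrs x, ∀ z ∈ latNbrs x, η y = false → η z = false → y = z) →
      clusterCountZ ℓ (flipCfg η x) = clusterCountZ ℓ η) := by
  have hfl : ∀ y, y ≠ x → flipCfg η x y = η y := fun y hy => by simp [flipCfg, hy]
  have hne : ∀ y ∈ latNbrs x, y ≠ x := by
    rintro y hy rfl; exact self_notMem_latNbrs _ hy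
  have habs : ∀ a b : ℕ, a ≤ b + 1 → b ≤ a + 2 * d → ((a : ℝ) - b) ^ 2 ≤ (2 * d + 1) ^ 2 := by
    intro a b h1 h2
    have h1' : (a : ℝ) ≤ b + 1 := by exact_mod_cast h1
    have h2' : (b : ℝ) ≤ a + 2 * d := by exact_mod_cast h2
    have : (0 : ℝ) ≤ d := Nat.cast_nonneg d
    apply sq_le_sq'
    · linarith
    · linarith
  cases hη : η x with
  | true =>
    obtain ⟨b1, b2, b3⟩ := cluster_bounds (ℓ := ℓ) η (flipCfg η x) x hx hη
      (by simp [flipCfg, hη]) (fun y hy => (hfl y hy).symm)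
    exact ⟨habs _ _ b1 b2, b3⟩
  | false =>
    obtain ⟨b1, b2, b3⟩ := cluster_bounds (ℓ := ℓ) (flipCfg η x) η x hx
      (by simp [flipCfg, hη]) hη (fun y hy => (hfl y hy))
    refine ⟨?_, ?_⟩
    · have := habs _ _ b1 b2
      nlinarith
    · rintro ⟨y, hy, hyb, hye⟩ hu
      refine (b3 ⟨y, hy, hyb, by rw [hfl y (hne y hy)]; exact hye⟩ ?_).symm
      intro y hy z hz
      rw [hfl y (hne y hy), hfl z (hne z hz)]
      exact hu y hy z hz

theorem flip_outside {d ℓ : ℕ} (η : (Fin d → ℤ) → Bool) (x : Fin d → ℤ) (hx : ¬ inBox ℓ x) :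
    clusterCountZ ℓ (flipCfg η x) = clusterCountZ ℓ η := by
  let e : {y : Fin d → ℤ // inBox ℓ y ∧ flipCfg η x y = false} ≃
      {y : Fin d → ℤ // inBox ℓ y ∧ η y = false} :=
    Equiv.subtypeEquivRight (by
      intro y
      refine and_congr_right fun hy => ?_
      have : y ≠ x := by rintro rfl; exact hx hy
      simp [flipCfg, this])
  let E : emptyGraphZ ℓ (flipCfg η x) ≃g emptyGraphZ ℓ η :=
    ⟨e, by intro a b; rw [emptyGraph_adj, emptyGraph_adj]; rfl⟩
  exact Nat.card_congr E.connectedComponentEquiv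

/-! ### Probability part -/

theorem Eloc_mono {d : ℕ} {q : ℝ} (hq : 0 ≤ q) (hq1 : q ≤ 1) (s : Finset (Fin d → ℤ))
    (g h : ((Fin d → ℤ) → Bool) → ℝ) (hgh : ∀ η, g η ≤ h η) : Eloc q s g ≤ Eloc q s h := by
  unfold Eloc
  refine Finset.sum_le_sum fun η _ => mul_le_mul_of_nonneg_left (hgh _) ?_
  refine Finset.prod_nonneg fun v _ => ?_
  split_ifs <;> linarith

theorem Eloc_mul_sum {d : ℕ} {ι : Type*} (q c : ℝ) (s : Finset (Fin d → ℤ)) (t : Finset ι)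
    (g : ι → ((Fin d → ℤ) → Bool) → ℝ) :
    Eloc q s (fun η => c * ∑ i ∈ t, g i η) = c * ∑ i ∈ t, Eloc q s (g i) := by
  unfold Eloc
  simp only [Finset.mul_sum]
  rw [Finset.sum_comm]
  refine Finset.sum_congr rfl fun i _ => Finset.sum_congr rfl fun η _ => by ring

theorem Eloc_ind {d : ℕ} (q : ℝ) (s t : Finset (Fin d → ℤ)) (ht : t ⊆ s) :
    Eloc q s (fun η => if ∀ y ∈ t, η y = false then 1 else 0) = q ^ t.card := by
  classical
  unfold Eloc
  have h1 : ∀ η : ↥s → Bool, (∏ v : ↥s, if η v then (1 - q) else q) *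
      (if ∀ y ∈ t, extendCfg s η y = false then (1 : ℝ) else 0) =
      ∏ v : ↥s, ((if η v then (1 - q) else q) * (if v.1 ∈ t ∧ η v = true then 0 else 1)) := by
    intro η
    rw [Finset.prod_mul_distrib]
    congr 1
    split_ifs with h
    · symm
      refine Finset.prod_eq_one fun v _ => ?_
      rw [if_neg]
      rintro ⟨hv, hv'⟩
      have := h v.1 hv
      simp [extendCfg, hv'] at this
    · push Not at h
      obtain ⟨y, hy, hy'⟩ := h
      symm
      refine Finset.prod_eq_zero (Finset.mem_univ ⟨y, ht hy⟩) ?_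
      rw [if_pos]
      refine ⟨hy, ?_⟩
      simpa [extendCfg, ht hy] using hy'
  rw [Finset.sum_congr rfl fun η _ => h1 η]
  rw [← Fintype.prod_sum (fun (v : ↥s) (b : Bool) =>
    (if b = true then (1 - q) else q) * (if v.1 ∈ t ∧ b = true then (0 : ℝ) else 1))]
  have h2 : ∀ v : ↥s, ∑ b : Bool, (if b = true then (1 - q) else q) *
      (if v.1 ∈ t ∧ b = true then (0 : ℝ) else 1) = if v.1 ∈ t then q else 1 := by
    intro v
    by_cases hv : v.1 ∈ t <;> simp [hv]
  rw [Finset.prod_congr rfl fun v _ => h2 v]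
  rw [Finset.prod_coe_sort s (fun v => if v ∈ t then q else 1), Finset.prod_ite_mem,
    Finset.inter_eq_right.2 ht, Finset.prod_const]

/-- The term of the Dirichlet form. -/
def dTerm {d : ℕ} (q : ℝ) (ℓ : ℕ) (x : Fin d → ℤ) : ℝ :=
  Eloc q (boxFinset d ℓ ∪ insert x (latNbrs x))
    (fun η => cInd η x * ((clusterCountZ ℓ (flipCfg η x) : ℝ) - clusterCountZ ℓ η) ^ 2)

theorem dTerm_outside {d : ℕ} (q : ℝ) (ℓ : ℕ) (x : Fin d → ℤ) (hx : x ∉ boxFinset d ℓ) :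
    dTerm q ℓ x = 0 := by
  rw [mem_box] at hx
  simp [dTerm, flip_outside _ _ hx, Eloc]

theorem dTerm_box {d : ℕ} {q : ℝ} (hq : 0 ≤ q) (hq1 : q ≤ 1) (ℓ : ℕ) (x : Fin d → ℤ)
    (hx : x ∈ boxFinset d ℓ) : dTerm q ℓ x ≤ (2 * d + 1) ^ 2 * (2 * d * q) := by
  rw [mem_box] at hx
  have h1 : dTerm q ℓ x ≤ Eloc q (boxFinset d ℓ ∪ insert x (latNbrs x))
      (fun η => (2 * d + 1) ^ 2 * ∑ y ∈ latNbrs x,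
        (fun η => if ∀ z ∈ ({y} : Finset (Fin d → ℤ)), η z = false then (1 : ℝ) else 0) η) := by
    refine Eloc_mono hq hq1 _ _ _ fun η => ?_
    have hb := (flip_bounds η x hx).1
    have hnn : ∀ y ∈ latNbrs x,
        (0 : ℝ) ≤ if ∀ z ∈ ({y} : Finset (Fin d → ℤ)), η z = false then (1 : ℝ) else 0 := by
      intro y _; split_ifs <;> norm_num
    unfold cInd
    split_ifs with h
    · obtain ⟨y, hy, hye⟩ := h
      have := Finset.single_le_sum hnn hy
      rw [if_pos (by simpa using hye)] at this
      rw [one_mul]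
      refine hb.trans ?_
      exact le_mul_of_one_le_right (by positivity) this
    · rw [zero_mul]
      exact mul_nonneg (by positivity) (Finset.sum_nonneg hnn)
  refine h1.trans ?_
  rw [Eloc_mul_sum]
  refine mul_le_mul_of_nonneg_left ?_ (by positivity)
  rw [Finset.sum_congr rfl (g := fun _ => q)]
  · rw [Finset.sum_const, nsmul_eq_mul]
    refine mul_le_mul_of_nonneg_right ?_ hq
    exact_mod_cast card_latNbrs_le x
  · intro y hy
    rw [Eloc_ind]
    · simp
    · intro z hz
      rw [Finset.mem_singleton] at hz
      subst hz
      simp [hy]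

theorem dTerm_interior {d : ℕ} {q : ℝ} (hq : 0 ≤ q) (hq1 : q ≤ 1) (ℓ : ℕ) (x : Fin d → ℤ)
    (hx : x ∈ boxFinset d ℓ) (hn : latNbrs x ⊆ boxFinset d ℓ) :
    dTerm q ℓ x ≤ (2 * d + 1) ^ 2 * ((2 * d) ^ 2 * q ^ 2) := by
  rw [mem_box] at hx
  have h1 : dTerm q ℓ x ≤ Eloc q (boxFinset d ℓ ∪ insert x (latNbrs x))
      (fun η => (2 * d + 1) ^ 2 * ∑ p ∈ (latNbrs x).offDiag,
        (fun η => if ∀ z ∈ ({p.1, p.2} : Finset (Fin d → ℤ)), η z = false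
          then (1 : ℝ) else 0) η) := by
    refine Eloc_mono hq hq1 _ _ _ fun η => ?_
    obtain ⟨hb, hb2⟩ := (flip_bounds η x hx)
    have hnn : ∀ p ∈ (latNbrs x).offDiag,
        (0 : ℝ) ≤ if ∀ z ∈ ({p.1, p.2} : Finset (Fin d → ℤ)), η z = false
          then (1 : ℝ) else 0 := by
      intro y _; split_ifs <;> norm_num
    have hR : 0 ≤ ((2 : ℝ) * d + 1) ^ 2 * ∑ p ∈ (latNbrs x).offDiag,
        (if ∀ z ∈ ({p.1, p.2} : Finset (Fin d → ℤ)), η z = false then (1 : ℝ) else 0) :=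
      mul_nonneg (by positivity) (Finset.sum_nonneg hnn)
    unfold cInd
    split_ifs with h
    · rw [one_mul]
      by_cases hu : ∀ y ∈ latNbrs x, ∀ z ∈ latNbrs x, η y = false → η z = false → y = z
      · obtain ⟨y, hy, hye⟩ := h
        rw [hb2 ⟨y, hy, (mem_box y).1 (hn hy), hye⟩ hu]
        simpa using hR
      · push Not at hu
        obtain ⟨y, hy, z, hz, hye, hze, hyz⟩ := hu
        have := Finset.single_le_sum hnn (Finset.mem_offDiag.2 ⟨hy, hz, hyz⟩ :
          (y, z) ∈ (latNbrs x).offDiag)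
        rw [if_pos (by simp [hye, hze])] at this
        refine hb.trans ?_
        exact le_mul_of_one_le_right (by positivity) this
    · rw [zero_mul]
      exact hR
  refine h1.trans ?_
  rw [Eloc_mul_sum]
  refine mul_le_mul_of_nonneg_left ?_ (by positivity)
  rw [Finset.sum_congr rfl (g := fun _ => q ^ 2)]
  · rw [Finset.sum_const, nsmul_eq_mul]
    refine mul_le_mul_of_nonneg_right ?_ (by positivity)
    have hc : (latNbrs x).offDiag.card ≤ (2 * d) ^ 2 := by
      rw [Finset.offDiag_card, sq]
      exact (Nat.sub_le _ _).trans (Nat.mul_le_mul (card_latNbrs_le x) (card_latNbrs_le x))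
    exact_mod_cast hc
  · intro p hp
    obtain ⟨h1, h2, h3⟩ := Finset.mem_offDiag.1 hp
    rw [Eloc_ind]
    · rw [Finset.card_pair h3]
    · intro z hz
      rw [Finset.mem_insert, Finset.mem_singleton] at hz
      rcases hz with rfl | rfl
      · simp [h1]
      · simp [h2]

/-! ### Counting -/

theorem card_box (d ℓ : ℕ) : (boxFinset d ℓ).card = ℓ ^ d := by
  simp [boxFinset]

theorem card_slice (d ℓ : ℕ) (i : Fin d) (c : ℤ) :
    ((boxFinset d ℓ).filter fun x => x i = c).card ≤ ℓ ^ (d - 1) := by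
  have hsub : ((boxFinset d ℓ).filter fun x => x i = c) ⊆
      Fintype.piFinset (fun j => if j = i then {c} else Finset.Ico (0 : ℤ) ℓ) := by
    intro x hx
    rw [Finset.mem_filter, boxFinset, Fintype.mem_piFinset] at hx
    rw [Fintype.mem_piFinset]
    intro j
    by_cases hj : j = i
    · subst hj; simp [hx.2]
    · simpa [hj] using hx.1 j
  refine (Finset.card_le_card hsub).trans ?_
  rw [Fintype.card_piFinset, ← Finset.mul_prod_erase _ _ (Finset.mem_univ i),
    Finset.prod_congr rfl (g := fun _ => ℓ)]
  · simp
  · intro j hj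
    simp [(Finset.mem_erase.1 hj).1]

theorem card_boundary (d ℓ : ℕ) :
    ((boxFinset d ℓ).filter fun x => ¬ latNbrs x ⊆ boxFinset d ℓ).card ≤
      d * (2 * ℓ ^ (d - 1)) := by
  classical
  have hsub : ((boxFinset d ℓ).filter fun x => ¬ latNbrs x ⊆ boxFinset d ℓ) ⊆
      Finset.univ.biUnion fun i : Fin d =>
        ((boxFinset d ℓ).filter fun x => x i = 0) ∪
        ((boxFinset d ℓ).filter fun x => x i = (ℓ : ℤ) - 1) := by
    intro x hx
    rw [Finset.mem_filter] at hx
    obtain ⟨hx, hn⟩ := hx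
    by_contra hc
    simp only [Finset.mem_biUnion, Finset.mem_univ, true_and, Finset.mem_union,
      Finset.mem_filter, hx, not_exists, not_or] at hc
    apply hn
    intro y hy
    rw [mem_box] at hx ⊢
    rw [mem_latNbrs_iff] at hy
    obtain ⟨i, hy⟩ := hy
    intro j
    have h1 := hx j
    have h2 := hc j
    by_cases hj : j = i
    · subst hj
      rcases hy with rfl | rfl
      · simp; omega
      · simp; omega
    · rcases hy with rfl | rfl
      · simp [hj]; omega
      · simp [hj]; omega
  refine (Finset.card_le_card hsub).trans (Finset.card_biUnion_le.trans ?_)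
  refine (Finset.sum_le_sum (g := fun _ => 2 * ℓ ^ (d - 1)) fun i _ => ?_).trans ?_
  · refine (Finset.card_union_le _ _).trans ?_
    have := card_slice d ℓ i 0
    have := card_slice d ℓ i ((ℓ : ℤ) - 1)
    omega
  · simp

theorem sum_dTerm_le {d : ℕ} {q : ℝ} (hq : 0 ≤ q) (hq1 : q ≤ 1) (ℓ : ℕ) :
    ∑' x : Fin d → ℤ, dTerm q ℓ x ≤
      (ℓ : ℝ) ^ d * ((2 * d + 1) ^ 2 * ((2 * d) ^ 2 * q ^ 2)) +
      (d * (2 * (ℓ : ℝ) ^ (d - 1))) * ((2 * d + 1) ^ 2 * (2 * d * q)) := by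
  classical
  rw [tsum_eq_sum (s := boxFinset d ℓ) fun x hx => dTerm_outside q ℓ x hx]
  rw [← Finset.sum_filter_add_sum_filter_not _ (fun x => latNbrs x ⊆ boxFinset d ℓ)]
  refine add_le_add ?_ ?_
  · refine (Finset.sum_le_card_nsmul _ _
      ((2 * d + 1) ^ 2 * ((2 * d) ^ 2 * q ^ 2)) fun x hx => ?_).trans ?_
    · rw [Finset.mem_filter] at hx
      exact dTerm_interior hq hq1 ℓ x hx.1 hx.2
    · rw [nsmul_eq_mul]
      refine mul_le_mul_of_nonneg_right ?_ (by positivity)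
      have := (Finset.card_filter_le (boxFinset d ℓ)
        (fun x => latNbrs x ⊆ boxFinset d ℓ)).trans (card_box d ℓ).le
      exact_mod_cast this
  · refine (Finset.sum_le_card_nsmul _ _
      ((2 * d + 1) ^ 2 * (2 * d * q)) fun x hx => ?_).trans ?_
    · rw [Finset.mem_filter] at hx
      exact dTerm_box hq hq1 ℓ x hx.1
    · rw [nsmul_eq_mul]
      refine mul_le_mul_of_nonneg_right ?_ (by positivity)
      exact_mod_cast card_boundary d ℓ

/-- for `d ≥ 3`, `ℓ = ⌊1/q⌋` and `f` the cluster-count in `Λ = {0,…,ℓ−1}^d`,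
the FA1f Dirichlet form satisfies `D(f) ≤ C q^{3−d}`, with `C` depending only on `d`. -/
theorem dirichlet_clusterCount_le (d : ℕ) (hd : 3 ≤ d) :
    ∃ C > (0 : ℝ), ∃ q₀ > (0 : ℝ), ∀ q : ℝ, 0 < q → q ≤ q₀ → q < 1 →
      Dform q (boxFinset d ⌊1 / q⌋₊)
          (fun η => (clusterCountZ ⌊1 / q⌋₊ η : ℝ)) ≤
        C * q ^ ((3 : ℤ) - (d : ℤ)) := by
  refine ⟨(2 * d + 1) ^ 2 * (2 * d) ^ 2 * 2, ?_, 1, one_pos, ?_⟩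
  · have : (0 : ℝ) < d := by exact_mod_cast (by omega : 0 < d)
    positivity
  intro q hq _ hq1
  have hD : Dform q (boxFinset d ⌊1 / q⌋₊) (fun η => (clusterCountZ ⌊1 / q⌋₊ η : ℝ)) =
      q * (1 - q) * ∑' x : Fin d → ℤ, dTerm q ⌊1 / q⌋₊ x := rfl
  rw [hD]
  have hs := sum_dTerm_le (d := d) hq.le hq1.le ⌊1 / q⌋₊
  generalize hℓ : ⌊1 / q⌋₊ = ℓ at *
  have hle : (ℓ : ℝ) ≤ q⁻¹ := by
    rw [← hℓ, ← one_div]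
    exact Nat.floor_le (by positivity)
  have hp1 : (ℓ : ℝ) ^ d ≤ (q⁻¹) ^ d := pow_le_pow_left₀ (Nat.cast_nonneg _) hle _
  have hp2 : (ℓ : ℝ) ^ (d - 1) ≤ (q⁻¹) ^ (d - 1) := pow_le_pow_left₀ (Nat.cast_nonneg _) hle _
  have hs2 : ∑' x : Fin d → ℤ, dTerm q ℓ x ≤
      (q⁻¹) ^ d * ((2 * d + 1) ^ 2 * ((2 * d) ^ 2 * q ^ 2)) +
      (d * (2 * (q⁻¹) ^ (d - 1))) * ((2 * d + 1) ^ 2 * (2 * d * q)) :=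
    hs.trans (by gcongr)
  have hpow : q ^ ((3 : ℤ) - (d : ℤ)) = q ^ 3 * (q⁻¹) ^ d := by
    rw [zpow_sub₀ hq.ne', zpow_natCast, inv_pow]
    rfl
  have hpow2 : (q⁻¹) ^ (d - 1) = q * (q⁻¹) ^ d := by
    obtain ⟨e, rfl⟩ : ∃ e, d = e + 1 := ⟨d - 1, by omega⟩
    rw [Nat.add_sub_cancel, pow_succ]
    field_simp
  rw [hpow2] at hs2
  rw [hpow]
  have hnn : 0 ≤ (2 * (d : ℝ) + 1) ^ 2 * (2 * d) ^ 2 * 2 * (q ^ 2 * (q⁻¹) ^ d) := by positivity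
  have hs3 : ∑' x : Fin d → ℤ, dTerm q ℓ x ≤
      (2 * (d : ℝ) + 1) ^ 2 * (2 * d) ^ 2 * 2 * (q ^ 2 * (q⁻¹) ^ d) := hs2.trans (by
    apply le_of_eq; ring)
  calc q * (1 - q) * ∑' x : Fin d → ℤ, dTerm q ℓ x
      ≤ q * (1 - q) * ((2 * (d : ℝ) + 1) ^ 2 * (2 * d) ^ 2 * 2 * (q ^ 2 * (q⁻¹) ^ d)) :=
        mul_le_mul_of_nonneg_left hs3 (mul_nonneg hq.le (by linarith))
    _ ≤ q * 1 * ((2 * (d : ℝ) + 1) ^ 2 * (2 * d) ^ 2 * 2 * (q ^ 2 * (q⁻¹) ^ d)) := by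
        gcongr
        linarith
    _ = _ := by ring

end
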